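/- arXiv:2209.13019 — 6 statements merged into one kernel-verified Lean document; each statement's English description precedes it below -/
import Mathlib

section
/- Fix n ≥ 1, m ≥ 1, a matrix μ ∈ [0,1]^{n×m}, and parameters β > 0, η > 0, α₁ < 1, α₂ < 1. For α ≠ 0 let ψ_α(x) = sign(α)(η + x)^α and let ψ₀(x) = log(η + x), for x ≥ 0. For a probability vector w on {1,…,n} and π ∈ [0,1]^{n×m}, define v_j(w, π) = Σ_{i=1}^n w_i π_{ij} and the normalized gradient of the two-sided fairness objective: g_{w,ij}(π) = ψ'_{α₁}(Σ_{j'=1}^m μ_{ij'} π_{ij'}) · μ_{ij} + (β/m) ψ'_{α₂}(v_j(w, π)). Let ‖ψ''_{α₂}‖_∞ = sup_{x≥0} |ψ''_{α₂}(x)|. Let T ≥ 1, let i^(1),…,i^(T) be i.i.d. samples from the categorical distribution with parameter w, let ŵ_i = #{τ ≤ T : i^(τ) = i}/T be the empirical frequencies, and let π̂ be any [0,1]^{n×m}-valued random matrix measurable with respect to (i^(1),…,i^(T)). Then for every user i ∈ {1,…,n}: E[ max_{j∈{1,…,m}} |g_{ŵ,ij}(π̂) − g_{w,ij}(π̂)|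 ] ≤ (β ‖ψ''_{α₂}‖_∞ / m) · √(n/T). -/
/-- `ψ_α(x) = sign(α) (η + x)^α` for `α ≠ 0`, and `ψ_0(x) = log (η + x)`. -/
noncomputable def psi (η α x : ℝ) : ℝ :=
  if α = 0 then Real.log (η + x) else Real.sign α * (η + x) ^ α

/-- The normalized gradient of the two-sided fairness objective:
`g_{w,ij}(π) = ψ'_{α₁}(Σ_{j'} μ_{ij'} π_{ij'}) μ_{ij} + (β/m) ψ'_{α₂}(Σ_{i'} w_{i'} π_{i'j})`,
where `psi1'` and `psi2'` stand for the derivatives `ψ'_{α₁}` and `ψ'_{α₂}`. -/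
noncomputable def gtwosided {n m : ℕ} (μ : Fin n → Fin m → ℝ) (β : ℝ)
    (psi1' psi2' : ℝ → ℝ) (w : Fin n → ℝ) (π : Fin n → Fin m → ℝ)
    (i : Fin n) (j : Fin m) : ℝ :=
  psi1' (∑ j', μ i j' * π i j') * μ i j + (β / (m : ℝ)) * psi2' (∑ i', w i' * π i' j)

/-- Number of occurrences of `i` in the history `h`. -/
def usercount {n T : ℕ} (h : Fin T → Fin n) (i : Fin n) : ℕ :=
  (Finset.univ.filter (fun τ => h τ = i)).card

/-- Under the i.i.d. product weights, the second moment of a sum of centered functions is additive. -/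
theorem sum_prod_mul_sq_sum_of_centered {ι : Type*} [Fintype ι] (w f : ι → ℝ)
    (hw : ∑ k, w k = 1) (hf : ∑ k, w k * f k = 0) (T : ℕ) :
    ∑ h : Fin T → ι, (∏ τ, w (h τ)) * (∑ τ, f (h τ)) ^ 2 = T * ∑ k, w k * f k ^ 2 := by
  induction T with
  | zero => simp
  | succ T ih =>
    rw [← (Fin.consEquiv fun _ => ι).sum_comp, Fintype.sum_prod_type, Finset.sum_comm]
    have htotal : ∑ h : Fin T → ι, ∏ τ, w (h τ) = 1 := by
      rw [← Fintype.sum_pow, hw, one_pow]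
    have hinner (h : Fin T → ι) :
        ∑ k, (∏ τ, w (Fin.consEquiv (fun _ => ι) (k, h) τ)) *
          (∑ τ, f (Fin.consEquiv (fun _ => ι) (k, h) τ)) ^ 2 =
        (∏ τ, w (h τ)) * (∑ k, w k * f k ^ 2) + (∏ τ, w (h τ)) * (∑ τ, f (h τ)) ^ 2 := by
      simp only [Fin.consEquiv_apply, Fin.prod_univ_succ, Fin.sum_univ_succ, Fin.cons_zero,
        Fin.cons_succ]
      set P := ∏ τ, w (h τ)
      set F := ∑ τ, f (h τ)
      have hexpand (k : ι) : w k * P * (f k + F) ^ 2 =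
          P * (w k * f k ^ 2) + 2 * P * F * (w k * f k) + P * F ^ 2 * w k := by ring
      simp only [hexpand, Finset.sum_add_distrib, ← Finset.mul_sum, hf, hw]
      ring
    rw [Finset.sum_congr rfl fun h _ => hinner h, Finset.sum_add_distrib, ← Finset.sum_mul,
      htotal, ih]
    push_cast
    ring

/-- The empirical frequencies of a history of length `T` have variance at most `w i / T`. -/
theorem sum_prod_mul_sq_frequency_sub_le {n T : ℕ} (w : Fin n → ℝ) (hw : ∑ i, w i = 1)
    (hT : 1 ≤ T) (i : Fin n) :
    ∑ h : Fin T → Fin n, (∏ τ, w (h τ)) * ((usercount h i : ℝ) / T - w i) ^ 2 ≤ w i / T := by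
  have hT0 : (0 : ℝ) < T := by exact_mod_cast hT
  let f : Fin n → ℝ := fun k => (if k = i then 1 else 0) - w i
  have hmean : ∑ k, w k * f k = 0 := by
    simp [f, mul_sub, Finset.sum_sub_distrib, ← Finset.sum_mul, hw]
  have hvar : ∑ k, w k * f k ^ 2 = w i - w i ^ 2 := by
    have hexpand (k : Fin n) : w k * f k ^ 2 =
        (if k = i then w k * (1 - 2 * w i) else 0) + w k * w i ^ 2 := by
      simp only [f]; split_ifs <;> ring
    simp only [hexpand, Finset.sum_add_distrib, ← Finset.sum_mul, hw, Finset.sum_ite_eq',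
      Finset.mem_univ, if_true]
    ring
  have hcount (h : Fin T → Fin n) : ((usercount h i : ℝ) / T - w i) ^ 2 =
      (∑ τ, f (h τ)) ^ 2 / T ^ 2 := by
    have hsum : ∑ τ, f (h τ) = usercount h i - T * w i := by
      simp [f, usercount, Finset.sum_sub_distrib]
    rw [hsum]
    field_simp
  simp only [hcount, ← mul_div_assoc, ← Finset.sum_div]
  rw [sum_prod_mul_sq_sum_of_centered w f hw hmean, hvar, div_le_div_iff₀ (by positivity) hT0]
  nlinarith [mul_nonneg (mul_nonneg hT0.le hT0.le) (sq_nonneg (w i))]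

/-- The expected `ℓ¹` distance between empirical and true frequencies is at most `√(n / T)`. -/
theorem sum_prod_mul_abs_frequency_sub_le {n T : ℕ} (w : Fin n → ℝ) (hw0 : ∀ i, 0 ≤ w i)
    (hw : ∑ i, w i = 1) (hT : 1 ≤ T) :
    ∑ h : Fin T → Fin n, (∏ τ, w (h τ)) * ∑ i, |(usercount h i : ℝ) / T - w i| ≤
      Real.sqrt (n / T) := by
  have hP (h : Fin T → Fin n) : 0 ≤ ∏ τ, w (h τ) := Finset.prod_nonneg fun τ _ => hw0 _
  apply Real.le_sqrt_of_sq_le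
  calc
    _ ≤ ∑ h : Fin T → Fin n, (∏ τ, w (h τ)) *
          (∑ i, |(usercount h i : ℝ) / T - w i|) ^ 2 :=
      Real.pow_arith_mean_le_arith_mean_pow _ _ _ (fun h _ => hP h)
        (by rw [← Fintype.sum_pow, hw, one_pow])
        (fun h _ => Finset.sum_nonneg fun i _ => abs_nonneg _) 2
    _ ≤ ∑ h : Fin T → Fin n, (∏ τ, w (h τ)) *
          (n * ∑ i, ((usercount h i : ℝ) / T - w i) ^ 2) := by
      refine Finset.sum_le_sum fun h _ => mul_le_mul_of_nonneg_left ?_ (hP h)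
      simpa using sq_sum_le_card_mul_sum_sq (s := Finset.univ)
        (f := fun i => |(usercount h i : ℝ) / T - w i|)
    _ = n * ∑ i, ∑ h : Fin T → Fin n, (∏ τ, w (h τ)) *
          ((usercount h i : ℝ) / T - w i) ^ 2 := by
      rw [Finset.sum_comm, Finset.mul_sum]
      refine Finset.sum_congr rfl fun h _ => ?_
      rw [← Finset.mul_sum]
      ring
    _ ≤ n * ∑ i, w i / T := by
      gcongr with i
      exact sum_prod_mul_sq_frequency_sub_le w hw hT i
    _ = n / T := by rw [← Finset.sum_div, hw, mul_one_div]

/-- Changing the user weights moves the gradient by at most their `ℓ¹` distance, up to the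
Lipschitz constant of `psi2'`. -/
theorem abs_gtwosided_sub_le {n m : ℕ} (μ : Fin n → Fin m → ℝ) {β M : ℝ} (hβ : 0 ≤ β)
    (psi1' : ℝ → ℝ) {psi2' psi2'' : ℝ → ℝ}
    (hpsi2'' : ∀ x : ℝ, 0 ≤ x → HasDerivAt psi2' (psi2'' x) x)
    (hM : ∀ x : ℝ, 0 ≤ x → |psi2'' x| ≤ M)
    {v w : Fin n → ℝ} (hv : ∀ i, 0 ≤ v i) (hw : ∀ i, 0 ≤ w i)
    {π : Fin n → Fin m → ℝ} (hπ : ∀ i j, π i j ∈ Set.Icc (0 : ℝ) 1) (i : Fin n) (j : Fin m) :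
    |gtwosided μ β psi1' psi2' v π i j - gtwosided μ β psi1' psi2' w π i j| ≤
      β * M / m * ∑ k, |v k - w k| := by
  have hM0 : 0 ≤ M := (abs_nonneg _).trans (hM 0 le_rfl)
  have hlip := (convex_Ici (0 : ℝ)).norm_image_sub_le_of_norm_hasDerivWithin_le
    (fun x hx => (hpsi2'' x hx).hasDerivWithinAt) (fun x hx => hM x hx)
    (Finset.sum_nonneg fun k _ => mul_nonneg (hw k) (hπ k j).1 : 0 ≤ ∑ k, w k * π k j)
    (Finset.sum_nonneg fun k _ => mul_nonneg (hv k) (hπ k j).1 : 0 ≤ ∑ k, v k * π k j)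
  simp only [Real.norm_eq_abs] at hlip
  have hsum : |∑ k, v k * π k j - ∑ k, w k * π k j| ≤ ∑ k, |v k - w k| := by
    rw [← Finset.sum_sub_distrib]
    refine (Finset.abs_sum_le_sum_abs _ _).trans (Finset.sum_le_sum fun k _ => ?_)
    rw [← sub_mul, abs_mul, abs_of_nonneg (hπ k j).1]
    exact mul_le_of_le_one_right (abs_nonneg _) (hπ k j).2
  rw [gtwosided, gtwosided, add_sub_add_left_eq_sub, ← mul_sub, abs_mul,
    abs_of_nonneg (by positivity : 0 ≤ β / m)]
  calc
    _ ≤ β / m * (M * ∑ k, |v k - w k|) := by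
      gcongr
      exact hlip.trans (by gcongr)
    _ = _ := by ring

/-- Deviation bound for the approximate gradient of the two-sided fairness objective
(Proposition 2, Algorithm 1).  The samples `i^{(1)},…,i^{(T)}` are encoded as a history
`h : Fin T → Fin n`, i.i.d. categorical with parameter `w`; the expectation of a
function `F` of the samples is `∑ h, (∏ τ, w (h τ)) * F h`; the empirical frequencies
are `ŵ_{i'} = usercount h i' / T`; and `π̂` is any `[0,1]`-valued matrix that is a
function of the samples.  `M` is an upper bound on `sup_{x ≥ 0} |ψ''_{α₂}(x)|`. -/
theorem twosided_gradient_deviation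
    (n m : ℕ) (hn : 1 ≤ n) (hm : 1 ≤ m)
    (μ : Fin n → Fin m → ℝ) (hμ : ∀ i j, μ i j ∈ Set.Icc (0 : ℝ) 1)
    (β η α₁ α₂ : ℝ) (hβ : 0 < β) (hη : 0 < η) (hα₁ : α₁ < 1) (hα₂ : α₂ < 1)
    (psi1' psi2' psi2'' : ℝ → ℝ)
    (hpsi1' : ∀ x : ℝ, 0 ≤ x → HasDerivAt (psi η α₁) (psi1' x) x)
    (hpsi2' : ∀ x : ℝ, 0 ≤ x → HasDerivAt (psi η α₂) (psi2' x) x)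
    (hpsi2'' : ∀ x : ℝ, 0 ≤ x → HasDerivAt psi2' (psi2'' x) x)
    (M : ℝ) (hM : ∀ x : ℝ, 0 ≤ x → |psi2'' x| ≤ M)
    (w : Fin n → ℝ) (hw0 : ∀ i, 0 ≤ w i) (hw1 : ∑ i, w i = 1)
    (T : ℕ) (hT : 1 ≤ T)
    (pihat : (Fin T → Fin n) → Fin n → Fin m → ℝ)
    (hpihat : ∀ h i j, pihat h i j ∈ Set.Icc (0 : ℝ) 1)
    (i : Fin n) :
    ∑ h : Fin T → Fin n, (∏ τ, w (h τ)) *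
      (⨆ j : Fin m,
        |gtwosided μ β psi1' psi2' (fun i' => (usercount h i' : ℝ) / (T : ℝ)) (pihat h) i j
          - gtwosided μ β psi1' psi2' w (pihat h) i j|)
      ≤ (β * M / (m : ℝ)) * Real.sqrt ((n : ℝ) / (T : ℝ)) := by
  have : Nonempty (Fin m) := ⟨⟨0, hm⟩⟩
  have hM0 : 0 ≤ M := (abs_nonneg _).trans (hM 0 le_rfl)
  calc
    _ ≤ ∑ h : Fin T → Fin n, (∏ τ, w (h τ)) *
          (β * M / m * ∑ k, |(usercount h k : ℝ) / T - w k|) := by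
      refine Finset.sum_le_sum fun h _ => mul_le_mul_of_nonneg_left (ciSup_le fun j => ?_)
        (Finset.prod_nonneg fun τ _ => hw0 _)
      exact abs_gtwosided_sub_le μ hβ.le psi1' hpsi2'' hM (fun k => by positivity) hw0
        (hpihat h) i j
    _ = β * M / m * ∑ h : Fin T → Fin n, (∏ τ, w (h τ)) *
          ∑ k, |(usercount h k : ℝ) / T - w k| := by
      simp only [mul_left_comm _ (β * M / m), ← Finset.mul_sum]
    _ ≤ _ := by
      gcongr
      exact sum_prod_mul_abs_frequency_sub_le w hw0 hw1 hT
end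

section
/- Fix n ≥ 1, m ≥ 1, a matrix μ ∈ [0,1]^{n×m}, parameters β > 0, η > 0, and a constant ‖b‖₁ ≥ 0. For a probability vector w on {1,…,n} and π ∈ [0,1]^{n×m}, define q_j(w) = Σ_{i=1}^n w_i μ_{ij}, q_avg(w) = (1/m) Σ_{j=1}^m q_j(w), v_j(w, π) = Σ_{i=1}^n w_i π_{ij}, x_j(w, π) = q_avg(w) v_j(w, π) − q_j(w) ‖b‖₁, Z(w, π) = √(η + (1/m) Σ_{j=1}^m x_j(w, π)²), and the normalized gradient of the quality-weighted exposure objective: g_{w,ij}(π) = μ_{ij} − (β/(m Z(w, π))) x_j(w, π). Let T ≥ 1, let i^(1),…,i^(T) be i.i.d. samples from the categorical distribution with parameter w, let ŵ_i = #{τ ≤ T : i^(τ) = i}/T, and let π̂ be any [0,1]^{n×m}-valued random matrix measurable with respect to (i^(1),…,i^(T)). Then for every user i ∈ {1,…,n}: E[ max_{j∈{1,…,m}} |g_{ŵ,ij}(π̂) − g_{w,ij}(π̂)| ] ≤ (β (2 + ‖b‖₁)² / (√m · min(η, √η))) · √(n/T). -/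
/-- `q_j(w) = Σ_i w_i μ_{ij}`. -/
noncomputable def qitem {n m : ℕ} (μ : Fin n → Fin m → ℝ) (w : Fin n → ℝ) (j : Fin m) : ℝ :=
  ∑ i, w i * μ i j

/-- `q_avg(w) = (1/m) Σ_j q_j(w)`. -/
noncomputable def qavg {n m : ℕ} (μ : Fin n → Fin m → ℝ) (w : Fin n → ℝ) : ℝ :=
  (1 / (m : ℝ)) * ∑ j, qitem μ w j

/-- `v_j(w, π) = Σ_i w_i π_{ij}`. -/
noncomputable def vitem {n m : ℕ} (w : Fin n → ℝ) (π : Fin n → Fin m → ℝ) (j : Fin m) : ℝ :=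
  ∑ i, w i * π i j

/-- `x_j(w, π) = q_avg(w) v_j(w,π) - q_j(w) ‖b‖₁`, where `b1 = ‖b‖₁`. -/
noncomputable def xqual {n m : ℕ} (μ : Fin n → Fin m → ℝ) (b1 : ℝ) (w : Fin n → ℝ)
    (π : Fin n → Fin m → ℝ) (j : Fin m) : ℝ :=
  qavg μ w * vitem w π j - qitem μ w j * b1

/-- `Z(w, π) = √(η + (1/m) Σ_j x_j(w,π)²)`. -/
noncomputable def Zqual {n m : ℕ} (μ : Fin n → Fin m → ℝ) (η b1 : ℝ) (w : Fin n → ℝ)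
    (π : Fin n → Fin m → ℝ) : ℝ :=
  Real.sqrt (η + (1 / (m : ℝ)) * ∑ j, (xqual μ b1 w π j) ^ 2)

/-- The normalized gradient of the quality-weighted exposure objective:
`g_{w,ij}(π) = μ_{ij} - (β/(m Z(w,π))) x_j(w,π)`. -/
noncomputable def gqual {n m : ℕ} (μ : Fin n → Fin m → ℝ) (β η b1 : ℝ) (w : Fin n → ℝ)
    (π : Fin n → Fin m → ℝ) (i : Fin n) (j : Fin m) : ℝ :=
  μ i j - (β / ((m : ℝ) * Zqual μ η b1 w π)) * xqual μ b1 w π j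

/-- The sum over all histories of a product over time steps factors. -/
theorem sum_history_prod {ι κ : Type*} [Fintype ι] [Fintype κ] [DecidableEq κ]
    (F : κ → ι → ℝ) : ∑ h : κ → ι, ∏ τ, F τ (h τ) = ∏ τ, ∑ k, F τ k := by
  rw [Finset.prod_univ_sum, Fintype.piFinset_univ]

/-- Second moment of a sum of i.i.d. centred variables over a finite alphabet. -/
theorem sum_history_sq_of_centred {ι κ : Type*} [Fintype ι] [Fintype κ] [DecidableEq κ]
    (w f : ι → ℝ) (hw1 : ∑ k, w k = 1) (hf : ∑ k, w k * f k = 0) :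
    ∑ h : κ → ι, (∏ τ, w (h τ)) * (∑ τ, f (h τ)) ^ 2
      = Fintype.card κ * ∑ k, w k * f k ^ 2 := by
  have pair : ∀ σ σ' : κ, ∑ h : κ → ι, (∏ τ, w (h τ)) * (f (h σ) * f (h σ'))
      = if σ = σ' then ∑ k, w k * f k ^ 2 else 0 := by
    intro σ σ'
    have h1 : ∀ h : κ → ι, (∏ τ, w (h τ)) * (f (h σ) * f (h σ'))
        = ∏ τ, w (h τ) * ((if τ = σ then f (h τ) else 1) * (if τ = σ' then f (h τ) else 1)) := by
      intro h
      rw [Finset.prod_mul_distrib, Finset.prod_mul_distrib]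
      simp
    simp_rw [h1]
    rw [sum_history_prod (fun τ k =>
      w k * ((if τ = σ then f k else 1) * (if τ = σ' then f k else 1)))]
    split_ifs with hs
    · subst hs
      rw [Finset.prod_eq_single σ]
      · simp [sq]
      · intro τ _ hτ
        simp [hτ, hw1]
      · simp
    · apply Finset.prod_eq_zero (Finset.mem_univ σ)
      simp [hs, hf]
  simp_rw [sq (∑ τ, f (_ : ι)), Finset.sum_mul_sum, Finset.mul_sum]
  rw [Finset.sum_comm]
  simp_rw [Finset.sum_comm (s := (Finset.univ : Finset (κ → ι))), pair]
  simp [Finset.mul_sum]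

/-- The counts of a history as a sum of indicators. -/
theorem usercount_eq_sum {n T : ℕ} (h : Fin T → Fin n) (k : Fin n) :
    (usercount h k : ℝ) = ∑ τ, if h τ = k then (1 : ℝ) else 0 := by
  simp [usercount]

theorem sum_usercount_div {n T : ℕ} (hT : 1 ≤ T) (h : Fin T → Fin n) :
    ∑ k, (usercount h k : ℝ) / (T : ℝ) = 1 := by
  have hT' : (T : ℝ) ≠ 0 := by positivity
  rw [← Finset.sum_div]
  simp_rw [usercount_eq_sum]
  rw [Finset.sum_comm]
  simp [hT']

/-- Variance of an empirical frequency. -/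
theorem variance_usercount_div {n T : ℕ} (hT : 1 ≤ T) (w : Fin n → ℝ)
    (hw1 : ∑ k, w k = 1) (k : Fin n) :
    ∑ h : Fin T → Fin n, (∏ τ, w (h τ)) * ((usercount h k : ℝ) / T - w k) ^ 2
      = (w k - w k ^ 2) / T := by
  have hT' : (T : ℝ) ≠ 0 := by positivity
  have hdev : ∀ h : Fin T → Fin n, (usercount h k : ℝ) / T - w k
      = (∑ τ, ((if h τ = k then (1 : ℝ) else 0) - w k)) / T := by
    intro h
    rw [Finset.sum_sub_distrib, ← usercount_eq_sum]
    simp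
    field_simp
  have hmean : ∑ l, w l * ((if l = k then (1 : ℝ) else 0) - w k) = 0 := by
    simp [mul_sub, Finset.sum_sub_distrib, ← Finset.sum_mul, hw1]
  have hvar : ∑ l, w l * ((if l = k then (1 : ℝ) else 0) - w k) ^ 2 = w k - w k ^ 2 := by
    have : ∀ l, w l * ((if l = k then (1 : ℝ) else 0) - w k) ^ 2
        = (if l = k then w l * (1 - 2 * w k) else 0) + w l * w k ^ 2 := by
      intro l
      split_ifs <;> ring
    simp_rw [this, Finset.sum_add_distrib, ← Finset.sum_mul, hw1]
    simp
    ring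
  simp_rw [hdev, div_pow, ← mul_div_assoc]
  rw [← Finset.sum_div, sum_history_sq_of_centred w
    (fun l => (if l = k then (1 : ℝ) else 0) - w k) hw1 hmean, hvar, Fintype.card_fin]
  field_simp

/-- Expected `ℓ¹` deviation of the empirical frequencies. -/
theorem expected_l1_deviation_le {n T : ℕ} (hT : 1 ≤ T) (w : Fin n → ℝ)
    (hw0 : ∀ k, 0 ≤ w k) (hw1 : ∑ k, w k = 1) :
    ∑ h : Fin T → Fin n, (∏ τ, w (h τ)) * ∑ k, |(usercount h k : ℝ) / T - w k|
      ≤ Real.sqrt ((n : ℝ) / T) := by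
  have hp0 : ∀ h : Fin T → Fin n, 0 ≤ ∏ τ, w (h τ) :=
    fun h => Finset.prod_nonneg fun τ _ => hw0 _
  have hp1 : ∑ h : Fin T → Fin n, ∏ τ, w (h τ) = 1 := by
    rw [sum_history_prod (fun _ k => w k)]
    simp [hw1]
  apply Real.le_sqrt_of_sq_le
  calc _ ≤ ∑ h : Fin T → Fin n, (∏ τ, w (h τ)) *
          (∑ k, |(usercount h k : ℝ) / T - w k|) ^ 2 :=
        Real.pow_arith_mean_le_arith_mean_pow _ _ _ (fun h _ => hp0 h) hp1
          (fun h _ => Finset.sum_nonneg fun k _ => abs_nonneg _) 2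
    _ ≤ ∑ h : Fin T → Fin n, (∏ τ, w (h τ)) *
          (n * ∑ k, ((usercount h k : ℝ) / T - w k) ^ 2) := by
        refine Finset.sum_le_sum fun h _ => mul_le_mul_of_nonneg_left ?_ (hp0 h)
        simpa using sq_sum_le_card_mul_sum_sq (s := Finset.univ)
          (f := fun k => |(usercount h k : ℝ) / T - w k|)
    _ = n * ∑ k, (w k - w k ^ 2) / T := by
        simp_rw [← variance_usercount_div hT w hw1, Finset.mul_sum]
        rw [Finset.sum_comm]
        refine Finset.sum_congr rfl fun k _ => Finset.sum_congr rfl fun h _ => ?_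
        ring
    _ ≤ n * ((∑ k, w k) / T) := by
        rw [Finset.sum_div]
        gcongr with k
        nlinarith [sq_nonneg (w k)]
    _ = n / T := by rw [hw1]; ring

theorem abs_sum_mul_sub_le {ι : Type*} [Fintype ι] (u w a : ι → ℝ)
    (ha : ∀ k, a k ∈ Set.Icc (0 : ℝ) 1) :
    |∑ k, u k * a k - ∑ k, w k * a k| ≤ ∑ k, |u k - w k| := by
  rw [← Finset.sum_sub_distrib]
  refine (Finset.abs_sum_le_sum_abs _ _).trans (Finset.sum_le_sum fun k _ => ?_)
  rw [← sub_mul, abs_mul, abs_of_nonneg (ha k).1]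
  exact mul_le_of_le_one_right (abs_nonneg _) (ha k).2

theorem sum_mul_mem_Icc {ι : Type*} [Fintype ι] (w a : ι → ℝ) (hw0 : ∀ k, 0 ≤ w k)
    (hw1 : ∑ k, w k = 1) (ha : ∀ k, a k ∈ Set.Icc (0 : ℝ) 1) :
    ∑ k, w k * a k ∈ Set.Icc (0 : ℝ) 1 := by
  refine ⟨Finset.sum_nonneg fun k _ => mul_nonneg (hw0 k) (ha k).1, ?_⟩
  rw [← hw1]
  exact Finset.sum_le_sum fun k _ => mul_le_of_le_one_right (hw0 k) (ha k).2

section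

variable {n m : ℕ} {μ π : Fin n → Fin m → ℝ} {u w : Fin n → ℝ} {b1 : ℝ}

theorem qavg_eq_sum (μ : Fin n → Fin m → ℝ) (w : Fin n → ℝ) :
    qavg μ w = ∑ k, w k * ((1 / (m : ℝ)) * ∑ j, μ k j) := by
  simp only [qavg, qitem, Finset.mul_sum]
  rw [Finset.sum_comm]
  exact Finset.sum_congr rfl fun k _ => Finset.sum_congr rfl fun j _ => by ring

theorem average_mem_Icc (hm : 1 ≤ m) (a : Fin m → ℝ) (ha : ∀ j, a j ∈ Set.Icc (0 : ℝ) 1) :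
    (1 / (m : ℝ)) * ∑ j, a j ∈ Set.Icc (0 : ℝ) 1 := by
  have hm' : (m : ℝ) ≠ 0 := by positivity
  rw [Finset.mul_sum]
  exact sum_mul_mem_Icc _ a (fun _ => by positivity) (by simp [hm']) ha

theorem abs_xqual_le (hm : 1 ≤ m) (hμ : ∀ i j, μ i j ∈ Set.Icc (0 : ℝ) 1)
    (hπ : ∀ i j, π i j ∈ Set.Icc (0 : ℝ) 1) (hb1 : 0 ≤ b1)
    (hw0 : ∀ k, 0 ≤ w k) (hw1 : ∑ k, w k = 1) (j : Fin m) :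
    |xqual μ b1 w π j| ≤ 1 + b1 := by
  have hq : qavg μ w ∈ Set.Icc (0 : ℝ) 1 := by
    rw [qavg_eq_sum]
    exact sum_mul_mem_Icc _ _ hw0 hw1 fun k => average_mem_Icc hm _ (hμ k)
  have hv : vitem w π j ∈ Set.Icc (0 : ℝ) 1 := sum_mul_mem_Icc _ _ hw0 hw1 fun k => hπ k j
  have hqj : qitem μ w j ∈ Set.Icc (0 : ℝ) 1 := sum_mul_mem_Icc _ _ hw0 hw1 fun k => hμ k j
  rw [xqual, abs_le]
  constructor <;>
    nlinarith [mul_nonneg hq.1 hv.1, mul_le_one₀ hq.2 hv.1 hv.2, mul_nonneg hqj.1 hb1,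
      mul_le_of_le_one_left hb1 hqj.2]

theorem abs_xqual_sub_le (hm : 1 ≤ m) (hμ : ∀ i j, μ i j ∈ Set.Icc (0 : ℝ) 1)
    (hπ : ∀ i j, π i j ∈ Set.Icc (0 : ℝ) 1) (hb1 : 0 ≤ b1)
    (hu0 : ∀ k, 0 ≤ u k) (hu1 : ∑ k, u k = 1)
    (hw0 : ∀ k, 0 ≤ w k) (hw1 : ∑ k, w k = 1) (j : Fin m) :
    |xqual μ b1 u π j - xqual μ b1 w π j| ≤ (2 + b1) * ∑ k, |u k - w k| := by
  have hq : qavg μ w ∈ Set.Icc (0 : ℝ) 1 := by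
    rw [qavg_eq_sum]
    exact sum_mul_mem_Icc _ _ hw0 hw1 fun k => average_mem_Icc hm _ (hμ k)
  have hv : vitem u π j ∈ Set.Icc (0 : ℝ) 1 := sum_mul_mem_Icc _ _ hu0 hu1 fun k => hπ k j
  have dq : |qavg μ u - qavg μ w| ≤ ∑ k, |u k - w k| := by
    rw [qavg_eq_sum, qavg_eq_sum]
    exact abs_sum_mul_sub_le _ _ _ fun k => average_mem_Icc hm _ (hμ k)
  have dv : |vitem u π j - vitem w π j| ≤ ∑ k, |u k - w k| :=
    abs_sum_mul_sub_le _ _ _ fun k => hπ k j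
  have dqj : |qitem μ u j - qitem μ w j| ≤ ∑ k, |u k - w k| :=
    abs_sum_mul_sub_le _ _ _ fun k => hμ k j
  have hsplit : xqual μ b1 u π j - xqual μ b1 w π j
      = (qavg μ u - qavg μ w) * vitem u π j + qavg μ w * (vitem u π j - vitem w π j)
        - (qitem μ u j - qitem μ w j) * b1 := by
    simp only [xqual]
    ring
  have h1 : |(qavg μ u - qavg μ w) * vitem u π j| ≤ ∑ k, |u k - w k| := by
    rw [abs_mul, abs_of_nonneg hv.1]
    exact (mul_le_of_le_one_right (abs_nonneg _) hv.2).trans dq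
  have h2 : |qavg μ w * (vitem u π j - vitem w π j)| ≤ ∑ k, |u k - w k| := by
    rw [abs_mul, abs_of_nonneg hq.1]
    exact (mul_le_of_le_one_left (abs_nonneg _) hq.2).trans dv
  have h3 : |(qitem μ u j - qitem μ w j) * b1| ≤ (∑ k, |u k - w k|) * b1 := by
    rw [abs_mul, abs_of_nonneg hb1]
    exact mul_le_mul_of_nonneg_right dqj hb1
  rw [hsplit]
  rw [abs_le] at *
  constructor <;> linarith [h1.1, h1.2, h2.1, h2.2, h3.1, h3.2]

end

/-- The regularised root mean square is `1`-Lipschitz for the sup norm. -/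
theorem sqrt_add_average_sq_le {m : ℕ} (hm : 1 ≤ m) {η c : ℝ} (hη : 0 ≤ η) (hc : 0 ≤ c)
    (x y : Fin m → ℝ) (hxy : ∀ j, |y j - x j| ≤ c) :
    Real.sqrt (η + (1 / (m : ℝ)) * ∑ j, y j ^ 2)
      ≤ Real.sqrt (η + (1 / (m : ℝ)) * ∑ j, x j ^ 2) + c := by
  have hm' : (0 : ℝ) < m := by positivity
  have hx0 : 0 ≤ η + (1 / (m : ℝ)) * ∑ j, x j ^ 2 := by positivity
  have hmean : (1 / (m : ℝ)) * ∑ j, |x j| ≤ Real.sqrt (η + (1 / (m : ℝ)) * ∑ j, x j ^ 2) := by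
    apply Real.le_sqrt_of_sq_le
    have := sq_sum_le_card_mul_sum_sq (s := Finset.univ) (f := fun j => |x j|)
    simp only [Finset.card_univ, Fintype.card_fin, sq_abs] at this
    calc ((1 / (m : ℝ)) * ∑ j, |x j|) ^ 2 = (1 / (m : ℝ)) ^ 2 * (∑ j, |x j|) ^ 2 := by ring
      _ ≤ (1 / (m : ℝ)) ^ 2 * (m * ∑ j, x j ^ 2) := by gcongr
      _ = (1 / (m : ℝ)) * ∑ j, x j ^ 2 := by field_simp
      _ ≤ _ := by linarith
  have hsum : (1 / (m : ℝ)) * ∑ j, y j ^ 2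
      ≤ (1 / (m : ℝ)) * ∑ j, x j ^ 2 + 2 * c * ((1 / (m : ℝ)) * ∑ j, |x j|) + c ^ 2 := by
    have hpt : ∑ j, y j ^ 2 ≤ ∑ j, (x j ^ 2 + 2 * c * |x j| + c ^ 2) := by
      refine Finset.sum_le_sum fun j _ => ?_
      have h1 : |y j| ≤ |x j| + c := by
        have := abs_add_le (x j) (y j - x j)
        rw [add_sub_cancel] at this
        linarith [hxy j]
      rw [← sq_abs (y j), ← sq_abs (x j)]
      nlinarith [abs_nonneg (y j), abs_nonneg (x j)]
    calc _ ≤ (1 / (m : ℝ)) * ∑ j, (x j ^ 2 + 2 * c * |x j| + c ^ 2) := by gcongr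
      _ = _ := by
        simp only [Finset.sum_add_distrib, ← Finset.mul_sum, Finset.sum_const,
          Finset.card_univ, Fintype.card_fin, nsmul_eq_mul]
        field_simp
  apply Real.sqrt_le_iff.2
  refine ⟨by positivity, ?_⟩
  rw [add_sq, Real.sq_sqrt hx0]
  nlinarith [mul_le_mul_of_nonneg_left hmean hc]

theorem abs_Zqual_sub_le {n m : ℕ} (hm : 1 ≤ m) {μ π : Fin n → Fin m → ℝ} {u w : Fin n → ℝ}
    {η b1 c : ℝ} (hη : 0 ≤ η) (hc : 0 ≤ c)
    (h : ∀ j, |xqual μ b1 u π j - xqual μ b1 w π j| ≤ c) :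
    |Zqual μ η b1 u π - Zqual μ η b1 w π| ≤ c := by
  have h1 := sqrt_add_average_sq_le hm hη hc _ _ h
  have h2 := sqrt_add_average_sq_le hm hη hc _ _ fun j => (abs_sub_comm _ _).trans_le (h j)
  rw [abs_le]
  constructor <;> simp only [Zqual] <;> linarith

theorem sqrt_le_Zqual {n m : ℕ} (μ π : Fin n → Fin m → ℝ) (w : Fin n → ℝ) (η b1 : ℝ) :
    Real.sqrt η ≤ Zqual μ η b1 w π := by
  apply Real.sqrt_le_sqrt
  have : 0 ≤ (1 / (m : ℝ)) * ∑ j, xqual μ b1 w π j ^ 2 := by positivity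
  linarith

/-- Stability of a quotient whose denominators are bounded below by `s`. -/
theorem abs_div_sub_div_le {x y X Y s B c : ℝ} (hs : 0 < s) (hX : s ≤ X) (hY : s ≤ Y)
    (hx : |x| ≤ B) (hyx : |y - x| ≤ c) (hYX : |Y - X| ≤ c) :
    |y / Y - x / X| ≤ (1 + B) * c / min (s ^ 2) s := by
  have hX0 : 0 < X := hs.trans_le hX
  have hY0 : 0 < Y := hs.trans_le hY
  have hc : 0 ≤ c := (abs_nonneg _).trans hyx
  have hB : 0 ≤ B := (abs_nonneg _).trans hx
  have hM : 0 < min (s ^ 2) s := lt_min (by positivity) hs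
  have hsplit : y / Y - x / X = (y - x) / Y - x * (Y - X) / (X * Y) := by
    field_simp
    ring
  have h1 : |(y - x) / Y| ≤ c / min (s ^ 2) s := by
    rw [abs_div, abs_of_pos hY0]
    exact div_le_div₀ hc hyx hM ((min_le_right _ _).trans hY)
  have h2 : |x * (Y - X) / (X * Y)| ≤ B * c / min (s ^ 2) s := by
    rw [abs_div, abs_of_pos (mul_pos hX0 hY0), abs_mul]
    refine div_le_div₀ (by positivity) (by gcongr) hM ((min_le_left _ _).trans ?_)
    rw [sq]
    gcongr
  rw [hsplit]
  calc _ ≤ |(y - x) / Y| + |x * (Y - X) / (X * Y)| := abs_sub _ _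
    _ ≤ c / min (s ^ 2) s + B * c / min (s ^ 2) s := add_le_add h1 h2
    _ = _ := by ring

/-- Lipschitz dependence of the gradient on the user weights, in `ℓ¹` norm. -/
theorem abs_gqual_sub_le {n m : ℕ} (hm : 1 ≤ m) {μ π : Fin n → Fin m → ℝ} {u w : Fin n → ℝ}
    {β η b1 : ℝ} (hμ : ∀ i j, μ i j ∈ Set.Icc (0 : ℝ) 1)
    (hπ : ∀ i j, π i j ∈ Set.Icc (0 : ℝ) 1) (hβ : 0 ≤ β) (hη : 0 < η) (hb1 : 0 ≤ b1)
    (hu0 : ∀ k, 0 ≤ u k) (hu1 : ∑ k, u k = 1)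
    (hw0 : ∀ k, 0 ≤ w k) (hw1 : ∑ k, w k = 1) (i : Fin n) (j : Fin m) :
    |gqual μ β η b1 u π i j - gqual μ β η b1 w π i j|
      ≤ β * (2 + b1) ^ 2 / (Real.sqrt m * min η (Real.sqrt η)) * ∑ k, |u k - w k| := by
  have hm1 : (1 : ℝ) ≤ m := by exact_mod_cast hm
  have hs : 0 < Real.sqrt η := Real.sqrt_pos.2 hη
  have hsm : Real.sqrt m ≤ m := Real.sqrt_le_iff.2 ⟨by positivity, by nlinarith⟩
  have hsm0 : 0 < Real.sqrt m := Real.sqrt_pos.2 (by positivity)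
  have hM : 0 < min η (Real.sqrt η) := lt_min hη hs
  have hx := fun j => abs_xqual_sub_le hm hμ hπ hb1 hu0 hu1 hw0 hw1 j
  have hquot := abs_div_sub_div_le hs (sqrt_le_Zqual μ π w η b1) (sqrt_le_Zqual μ π u η b1)
    (abs_xqual_le hm hμ hπ hb1 hw0 hw1 j) (hx j) (abs_Zqual_sub_le hm hη.le (by positivity) hx)
  rw [Real.sq_sqrt hη.le] at hquot
  have hg : gqual μ β η b1 u π i j - gqual μ β η b1 w π i j
      = -(β / m * (xqual μ b1 u π j / Zqual μ η b1 u π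
          - xqual μ b1 w π j / Zqual μ η b1 w π)) := by
    simp only [gqual, div_eq_mul_inv, mul_inv]
    ring
  rw [hg, abs_neg, abs_mul, abs_of_nonneg (by positivity : 0 ≤ β / (m : ℝ))]
  calc _ ≤ β / Real.sqrt m * ((1 + (1 + b1)) * ((2 + b1) * ∑ k, |u k - w k|)
        / min η (Real.sqrt η)) := by gcongr
    _ = _ := by
      field_simp
      ring

/-- Deviation bound for the approximate gradient of the quality-weighted exposure
objective (Proposition 2, Algorithm 2).  The samples `i^{(1)},…,i^{(T)}` are encoded
as a history `h : Fin T → Fin n`, i.i.d. categorical with parameter `w`; the expectation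
of a function `F` of the samples is `∑ h, (∏ τ, w (h τ)) * F h`; the empirical
frequencies are `ŵ_{i'} = usercount h i' / T`. -/
theorem quality_weighted_gradient_deviation
    (n m : ℕ) (hn : 1 ≤ n) (hm : 1 ≤ m)
    (μ : Fin n → Fin m → ℝ) (hμ : ∀ i j, μ i j ∈ Set.Icc (0 : ℝ) 1)
    (β η : ℝ) (hβ : 0 < β) (hη : 0 < η)
    (b1 : ℝ) (hb1 : 0 ≤ b1)
    (w : Fin n → ℝ) (hw0 : ∀ i, 0 ≤ w i) (hw1 : ∑ i, w i = 1)
    (T : ℕ) (hT : 1 ≤ T)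
    (pihat : (Fin T → Fin n) → Fin n → Fin m → ℝ)
    (hpihat : ∀ h i j, pihat h i j ∈ Set.Icc (0 : ℝ) 1)
    (i : Fin n) :
    ∑ h : Fin T → Fin n, (∏ τ, w (h τ)) *
      (⨆ j : Fin m,
        |gqual μ β η b1 (fun i' => (usercount h i' : ℝ) / (T : ℝ)) (pihat h) i j
          - gqual μ β η b1 w (pihat h) i j|)
      ≤ (β * (2 + b1) ^ 2 / (Real.sqrt (m : ℝ) * min η (Real.sqrt η)))
        * Real.sqrt ((n : ℝ) / (T : ℝ)) := by
  have : Nonempty (Fin m) := ⟨⟨0, hm⟩⟩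
  set C := β * (2 + b1) ^ 2 / (Real.sqrt (m : ℝ) * min η (Real.sqrt η)) with hC
  have hC0 : 0 ≤ C := by positivity
  calc _ ≤ ∑ h : Fin T → Fin n, (∏ τ, w (h τ)) *
        (C * ∑ k, |(usercount h k : ℝ) / T - w k|) := by
        refine Finset.sum_le_sum fun h _ => mul_le_mul_of_nonneg_left
          (ciSup_le fun j => ?_) (Finset.prod_nonneg fun τ _ => hw0 _)
        exact abs_gqual_sub_le hm hμ (hpihat h) hβ.le hη hb1 (fun k => by positivity)
          (sum_usercount_div hT h) hw0 hw1 i j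
    _ = C * ∑ h : Fin T → Fin n, (∏ τ, w (h τ)) *
        ∑ k, |(usercount h k : ℝ) / T - w k| := by
        rw [Finset.mul_sum]
        exact Finset.sum_congr rfl fun h _ => by ring
    _ ≤ _ := mul_le_mul_of_nonneg_left (expected_l1_deviation_le hT w hw0 hw1) hC0
end

section
/- Fix n ≥ 1, m ≥ 1, a matrix μ ∈ [0,1]^{n×m}, and parameters β > 0, η > 0, α₁ < 1, α₂ < 1. For α ≠ 0 let ψ_α(x) = sign(α)(η + x)^α and let ψ₀(x) = log(η + x), for x ≥ 0. For a probability vector w on {1,…,n} and π ∈ [0,1]^{n×m}, define v_j(w, π) = Σ_{i=1}^n w_i π_{ij} and g_{w,ij}(π) = ψ'_{α₁}(Σ_{j'=1}^m μ_{ij'} π_{ij'}) · μ_{ij} + (β/m) ψ'_{α₂}(v_j(w, π)). Let ‖ψ''_{α₂}‖_∞ = sup_{x≥0} |ψ''_{α₂}(x)|. Then for any two probability vectors w, ŵ on {1,…,n}, any π ∈ [0,1]^{n×m}, and any user i: max_{j∈{1,…,m}} |g_{w,ij}(π) − g_{ŵ,ij}(π)| ≤ (β/m) ‖ψ''_{α₂}‖_∞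 Σ_{i'=1}^n |ŵ_{i'} − w_{i'}|. -/
/-- Two averages of a family with values in `[0, 1]` differ by at most the `ℓ¹` distance of
their weights. -/
theorem abs_sum_mul_sub_sum_mul_le {ι : Type*} [Fintype ι] (u v p : ι → ℝ)
    (hp : ∀ k, p k ∈ Set.Icc (0 : ℝ) 1) :
    |∑ k, u k * p k - ∑ k, v k * p k| ≤ ∑ k, |v k - u k| := by
  rw [← Finset.sum_sub_distrib]
  refine (Finset.abs_sum_le_sum_abs _ _).trans (Finset.sum_le_sum fun k _ => ?_)
  rw [← sub_mul, abs_mul, abs_of_nonneg (hp k).1, abs_sub_comm]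
  exact mul_le_of_le_one_right (abs_nonneg _) (hp k).2

/-- A function whose derivative is bounded by `M` on `[0, ∞)` is `M`-Lipschitz there. -/
theorem abs_sub_le_of_abs_hasDerivAt_le_of_nonneg {f f' : ℝ → ℝ} {M x y : ℝ}
    (hf : ∀ z, 0 ≤ z → HasDerivAt f (f' z) z) (hM : ∀ z, 0 ≤ z → |f' z| ≤ M)
    (hx : 0 ≤ x) (hy : 0 ≤ y) : |f x - f y| ≤ M * |x - y| :=
  (convex_Ici (0 : ℝ)).norm_image_sub_le_of_norm_hasDerivWithin_le
    (fun z hz => (hf z hz).hasDerivWithinAt) hM hy hx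

/-- Lipschitz dependence of the two-sided fairness gradient on the user-activity
vector: `max_j |g_{w,ij}(π) - g_{ŵ,ij}(π)| ≤ (β/m) ‖ψ''_{α₂}‖_∞ Σ_{i'} |ŵ_{i'} - w_{i'}|`.
`M` is an upper bound on `sup_{x ≥ 0} |ψ''_{α₂}(x)|`. -/
theorem twosided_gradient_w_lipschitz
    (n m : ℕ) (hn : 1 ≤ n) (hm : 1 ≤ m)
    (μ : Fin n → Fin m → ℝ) (hμ : ∀ i j, μ i j ∈ Set.Icc (0 : ℝ) 1)
    (β η α₁ α₂ : ℝ) (hβ : 0 < β) (hη : 0 < η) (hα₁ : α₁ < 1) (hα₂ : α₂ < 1)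
    (psi1' psi2' psi2'' : ℝ → ℝ)
    (hpsi1' : ∀ x : ℝ, 0 ≤ x → HasDerivAt (psi η α₁) (psi1' x) x)
    (hpsi2' : ∀ x : ℝ, 0 ≤ x → HasDerivAt (psi η α₂) (psi2' x) x)
    (hpsi2'' : ∀ x : ℝ, 0 ≤ x → HasDerivAt psi2' (psi2'' x) x)
    (M : ℝ) (hM : ∀ x : ℝ, 0 ≤ x → |psi2'' x| ≤ M)
    (w what : Fin n → ℝ)
    (hw0 : ∀ i, 0 ≤ w i) (hw1 : ∑ i, w i = 1)
    (hwh0 : ∀ i, 0 ≤ what i) (hwh1 : ∑ i, what i = 1)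
    (π : Fin n → Fin m → ℝ) (hπ : ∀ i j, π i j ∈ Set.Icc (0 : ℝ) 1)
    (i : Fin n) :
    (⨆ j : Fin m,
      |gtwosided μ β psi1' psi2' w π i j - gtwosided μ β psi1' psi2' what π i j|)
      ≤ (β / (m : ℝ)) * M * ∑ i', |what i' - w i'| := by
  have : Nonempty (Fin m) := ⟨⟨0, hm⟩⟩
  have hM0 : 0 ≤ M := (abs_nonneg _).trans (hM 0 le_rfl)
  refine ciSup_le fun j => ?_
  have hv : ∀ u : Fin n → ℝ, (∀ k, 0 ≤ u k) → 0 ≤ ∑ k, u k * π k j := fun u hu =>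
    Finset.sum_nonneg fun k _ => mul_nonneg (hu k) (hπ k j).1
  rw [gtwosided, gtwosided, add_sub_add_left_eq_sub, ← mul_sub, abs_mul,
    abs_of_nonneg (by positivity : 0 ≤ β / (m : ℝ)), mul_assoc]
  gcongr
  exact (abs_sub_le_of_abs_hasDerivAt_le_of_nonneg hpsi2'' hM (hv w hw0) (hv what hwh0)).trans
    (mul_le_mul_of_nonneg_left
      (abs_sum_mul_sub_sum_mul_le w what (fun k => π k j) fun k => hπ k j) hM0)
end

section
/- Let t ∈ ℕ, p ∈ [0,1], and let X be a binomial random variable with t trials and success probability p. Then E[ p²(t+1) / (X+1)² ] ≤ 2/(t+1). -/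
/-- Lowering the upper and lower indices of a binomial coefficient by two, over the reals. -/
theorem cast_choose_add_two (t x : ℕ) :
    ((t : ℝ) + 2) * ((t : ℝ) + 1) * (t.choose x : ℝ)
      = ((t + 2).choose (x + 2) : ℝ) * ((x : ℝ) + 2) * ((x : ℝ) + 1) := by
  have h₁ : ((t : ℝ) + 1) * (t.choose x : ℝ) = ((t + 1).choose (x + 1) : ℝ) * ((x : ℝ) + 1) := by
    exact_mod_cast Nat.add_one_mul_choose_eq t x
  have h₂ : ((t : ℝ) + 2) * ((t + 1).choose (x + 1) : ℝ)
      = ((t + 2).choose (x + 2) : ℝ) * ((x : ℝ) + 2) := by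
    exact_mod_cast Nat.add_one_mul_choose_eq (t + 1) (x + 1)
  linear_combination ((t : ℝ) + 2) * h₁ + ((x : ℝ) + 1) * h₂

/-- The probability that a `Bin(p, t + 2)` variable is at least two is at most one. -/
theorem sum_binomial_add_two_le_one (t : ℕ) {p : ℝ} (hp : p ∈ Set.Icc (0 : ℝ) 1) :
    ∑ x ∈ Finset.range (t + 1),
      ((t + 2).choose (x + 2) : ℝ) * p ^ (x + 2) * (1 - p) ^ (t - x) ≤ 1 := by
  obtain ⟨h0, h1⟩ := hp
  have hq : 0 ≤ 1 - p := sub_nonneg.2 h1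
  have total := add_pow p (1 - p) (t + 2)
  rw [add_sub_cancel, one_pow, Finset.sum_range_succ', Finset.sum_range_succ'] at total
  refine le_of_le_of_eq ?_ total.symm
  rw [add_assoc]
  refine (Finset.sum_le_sum fun x _ => le_of_eq ?_).trans (le_add_of_nonneg_right (by positivity))
  rw [show t + 2 - (x + 1 + 1) = t - x by omega]
  ring

/-- Since `x + 2 ≤ 2 * (x + 1)`, each weighted binomial coefficient is controlled by one with both
indices raised by two. -/
theorem choose_mul_div_sq_le (t x : ℕ) :
    (t.choose x : ℝ) * (((t : ℝ) + 1) / ((x : ℝ) + 1) ^ 2)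
      ≤ 2 / ((t : ℝ) + 2) * ((t + 2).choose (x + 2) : ℝ) := by
  rw [← mul_div_assoc, div_mul_eq_mul_div, div_le_div_iff₀ (by positivity) (by positivity)]
  have hx : (0 : ℝ) ≤ ((t + 2).choose (x + 2) : ℝ) * ((x : ℝ) + 1) * (x : ℝ) := by positivity
  linear_combination cast_choose_add_two t x + hx

/-- For `X ~ Bin(p, t)`: `E[p²(t+1)/(X+1)²] ≤ 2/(t+1)`.  The expectation is written
out as the finite sum `∑_{x=0}^{t} C(t,x) p^x (1-p)^{t-x} · p²(t+1)/(x+1)²`. -/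
theorem binomial_expectation_sq_bound (t : ℕ) (p : ℝ) (hp : p ∈ Set.Icc (0 : ℝ) 1) :
    ∑ x ∈ Finset.range (t + 1),
      (t.choose x : ℝ) * p ^ x * (1 - p) ^ (t - x)
        * (p ^ 2 * ((t : ℝ) + 1) / ((x : ℝ) + 1) ^ 2)
      ≤ 2 / ((t : ℝ) + 1) := by
  have hq : 0 ≤ 1 - p := sub_nonneg.2 hp.2
  have hp0 : 0 ≤ p := hp.1
  calc
    _ ≤ ∑ x ∈ Finset.range (t + 1), 2 / ((t : ℝ) + 2)
          * (((t + 2).choose (x + 2) : ℝ) * p ^ (x + 2) * (1 - p) ^ (t - x)) := by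
      refine Finset.sum_le_sum fun x _ => ?_
      have h := mul_le_mul_of_nonneg_right (choose_mul_div_sq_le t x)
        (show 0 ≤ p ^ (x + 2) * (1 - p) ^ (t - x) by positivity)
      linear_combination h
    _ ≤ 2 / ((t : ℝ) + 2) := by
      rw [← Finset.mul_sum]
      exact mul_le_of_le_one_right (by positivity) (sum_binomial_add_two_le_one t hp)
    _ ≤ 2 / ((t : ℝ) + 1) := by gcongr; norm_num
end

section
/- Let t ∈ ℕ, p ∈ (0,1], and let X be a binomial random variable with t trials and success probability p. Then E[ 1/(X+1)² ] ≤ 2/(p²(t+1)²). -/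
/-- Absorption inequality `(t+1)² C(t,x) ≤ 2 (x+1)² C(t+2,x+2)`. -/
theorem Nat.choose_mul_succ_sq_le (t x : ℕ) :
    t.choose x * (t + 1) ^ 2 ≤ 2 * (t + 2).choose (x + 2) * (x + 1) ^ 2 := by
  have h₁ := Nat.add_one_mul_choose_eq t x
  have h₂ := Nat.add_one_mul_choose_eq (t + 1) (x + 1)
  calc t.choose x * (t + 1) ^ 2
      ≤ t.choose x * ((t + 1) * (t + 2)) := by gcongr; nlinarith
    _ = (t + 1 + 1) * ((t + 1) * t.choose x) := by ring
    _ = ((t + 1 + 1) * (t + 1).choose (x + 1)) * (x + 1) := by rw [h₁]; ring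
    _ = (t + 2).choose (x + 2) * ((x + 2) * (x + 1)) := by rw [h₂]; ring
    _ ≤ (t + 2).choose (x + 2) * (2 * (x + 1) ^ 2) := Nat.mul_le_mul_left _ (by nlinarith)
    _ = 2 * (t + 2).choose (x + 2) * (x + 1) ^ 2 := by ring

/-- A binomial variable with `t + 2` trials is at least `2` with probability at most `1`. -/
theorem sum_binomial_shift_two_le_one (t : ℕ) {p : ℝ} (hp₀ : 0 ≤ p) (hp₁ : p ≤ 1) :
    ∑ x ∈ Finset.range (t + 1),
      ((t + 2).choose (x + 2) : ℝ) * p ^ (x + 2) * (1 - p) ^ (t - x) ≤ 1 := by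
  have hq : 0 ≤ 1 - p := sub_nonneg.2 hp₁
  have h := add_pow p (1 - p) (t + 2)
  rw [add_sub_cancel, one_pow, Finset.sum_range_succ', Finset.sum_range_succ'] at h
  refine le_of_le_of_eq ?_ h.symm
  rw [add_assoc]
  refine le_add_of_le_of_nonneg (Finset.sum_le_sum fun x _ => ?_) (by positivity)
  rw [show t + 2 - (x + 1 + 1) = t - x by omega]
  exact le_of_eq (by ring)

/-- For `X ~ Bin(p, t)` with `p ∈ (0,1]`: `E[1/(X+1)²] ≤ 2/(p²(t+1)²)`.  The
expectation is written out as the finite sum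
`∑_{x=0}^{t} C(t,x) p^x (1-p)^{t-x} / (x+1)²`. -/
theorem binomial_expectation_inv_sq_bound (t : ℕ) (p : ℝ) (hp : p ∈ Set.Ioc (0 : ℝ) 1) :
    ∑ x ∈ Finset.range (t + 1),
      (t.choose x : ℝ) * p ^ x * (1 - p) ^ (t - x) * (1 / ((x : ℝ) + 1) ^ 2)
      ≤ 2 / (p ^ 2 * ((t : ℝ) + 1) ^ 2) := by
  obtain ⟨hp₀, hp₁⟩ := hp
  have hq : 0 ≤ 1 - p := sub_nonneg.2 hp₁
  calc ∑ x ∈ Finset.range (t + 1),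
        (t.choose x : ℝ) * p ^ x * (1 - p) ^ (t - x) * (1 / ((x : ℝ) + 1) ^ 2)
      ≤ ∑ x ∈ Finset.range (t + 1), 2 / (p ^ 2 * ((t : ℝ) + 1) ^ 2) *
          (((t + 2).choose (x + 2) : ℝ) * p ^ (x + 2) * (1 - p) ^ (t - x)) := by
        refine Finset.sum_le_sum fun x _ => ?_
        have h : (t.choose x : ℝ) * ((t : ℝ) + 1) ^ 2
            ≤ 2 * ((t + 2).choose (x + 2) : ℝ) * ((x : ℝ) + 1) ^ 2 := by
          exact_mod_cast Nat.choose_mul_succ_sq_le t x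
        have h' : (t.choose x : ℝ) / ((x : ℝ) + 1) ^ 2
            ≤ 2 * ((t + 2).choose (x + 2) : ℝ) / ((t : ℝ) + 1) ^ 2 := by
          rwa [div_le_div_iff₀ (by positivity) (by positivity)]
        calc (t.choose x : ℝ) * p ^ x * (1 - p) ^ (t - x) * (1 / ((x : ℝ) + 1) ^ 2)
            = (t.choose x : ℝ) / ((x : ℝ) + 1) ^ 2 * (p ^ x * (1 - p) ^ (t - x)) := by ring
          _ ≤ 2 * ((t + 2).choose (x + 2) : ℝ) / ((t : ℝ) + 1) ^ 2 *
                (p ^ x * (1 - p) ^ (t - x)) := by gcongr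
          _ = _ := by field_simp; ring
    _ = 2 / (p ^ 2 * ((t : ℝ) + 1) ^ 2) * ∑ x ∈ Finset.range (t + 1),
          ((t + 2).choose (x + 2) : ℝ) * p ^ (x + 2) * (1 - p) ^ (t - x) := by
        rw [Finset.mul_sum]
    _ ≤ 2 / (p ^ 2 * ((t : ℝ) + 1) ^ 2) :=
        mul_le_of_le_one_right (by positivity) (sum_binomial_shift_two_le_one t hp₀.le hp₁)
end

section
/- Let t ≥ 1, w ∈ (0,1], and let X be a binomial random variable with t trials and success probability w. Then E[ | w(t+1)/(X+1) − 1 | ] ≤ 3/(2√(w(t+1))) + 1/(w(t+1)). -/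
open Finset in
/-- The variance of a binomial random variable, as a finite sum. -/
theorem sum_binomial_mul_sq_sub_mean (n : ℕ) (w : ℝ) :
    ∑ y ∈ range (n + 1),
      (n.choose y : ℝ) * w ^ y * (1 - w) ^ (n - y) * (n * w - y) ^ 2 = n * w * (1 - w) := by
  have h := congrArg (Polynomial.eval w) (bernsteinPolynomial.variance ℝ n)
  simp only [Polynomial.eval_finsetSum, bernsteinPolynomial] at h
  simp at h
  rw [← h]
  exact sum_congr rfl fun y _ => by ring

open Finset in
theorem sum_binomial (n : ℕ) (w : ℝ) :
    ∑ y ∈ range (n + 1), (n.choose y : ℝ) * w ^ y * (1 - w) ^ (n - y) = 1 := by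
  have h := add_pow w (1 - w) n
  rw [add_sub_cancel, one_pow] at h
  exact (sum_congr rfl fun y _ => by ring).trans h.symm

open Finset in
/-- The mean absolute deviation of a binomial random variable is at most the square root of
its mean. -/
theorem sum_binomial_mul_abs_sub_mean_le (n : ℕ) (hn : 0 < n) {w : ℝ} (hw0 : 0 < w)
    (hw1 : w ≤ 1) :
    ∑ y ∈ range (n + 1), (n.choose y : ℝ) * w ^ y * (1 - w) ^ (n - y) * |n * w - y|
      ≤ √(n * w) := by
  have hn' : (0 : ℝ) < n := Nat.cast_pos.2 hn
  have hm : 0 < (n : ℝ) * w := by positivity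
  have hw : 0 ≤ 1 - w := by linarith
  have hs : 0 < √(n * w) := Real.sqrt_pos.2 hm
  have hsq : √(n * w) ^ 2 = n * w := Real.sq_sqrt hm.le
  have amgm (d : ℝ) : 2 * √(n * w) * |d| ≤ d ^ 2 + n * w := by
    nlinarith [sq_nonneg (|d| - √(n * w)), sq_abs d]
  have key : 2 * √(n * w) *
      ∑ y ∈ range (n + 1), (n.choose y : ℝ) * w ^ y * (1 - w) ^ (n - y) * |n * w - y|
      ≤ n * w * (1 - w) + n * w := by
    calc _ ≤ ∑ y ∈ range (n + 1),
          ((n.choose y : ℝ) * w ^ y * (1 - w) ^ (n - y) * (n * w - y) ^ 2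
            + (n.choose y : ℝ) * w ^ y * (1 - w) ^ (n - y) * (n * w)) := by
          rw [mul_sum]
          refine sum_le_sum fun y _ => ?_
          have hb : 0 ≤ (n.choose y : ℝ) * w ^ y * (1 - w) ^ (n - y) := by positivity
          nlinarith [mul_le_mul_of_nonneg_left (amgm (n * w - y)) hb]
      _ = _ := by
          rw [sum_add_distrib, ← sum_mul, sum_binomial_mul_sq_sub_mean, sum_binomial, one_mul]
  refine le_of_mul_le_mul_left (key.trans ?_) (mul_pos two_pos hs)
  nlinarith [mul_pos hm hw0]

/-- For `X ~ Bin(w, t)` with `t ≥ 1` and `w ∈ (0,1]`: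
`E[|w(t+1)/(X+1) - 1|] ≤ 3/(2√(w(t+1))) + 1/(w(t+1))` (Lemma 3).  The expectation
is written out as the finite sum over `x ∈ {0,…,t}` of
`C(t,x) w^x (1-w)^{t-x} |w(t+1)/(x+1) - 1|`. -/
theorem binomial_stepsize_deviation (t : ℕ) (ht : 1 ≤ t) (w : ℝ)
    (hw : w ∈ Set.Ioc (0 : ℝ) 1) :
    ∑ x ∈ Finset.range (t + 1),
      (t.choose x : ℝ) * w ^ x * (1 - w) ^ (t - x)
        * |w * ((t : ℝ) + 1) / ((x : ℝ) + 1) - 1|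
      ≤ 3 / (2 * Real.sqrt (w * ((t : ℝ) + 1))) + 1 / (w * ((t : ℝ) + 1)) := by
  obtain ⟨hw0, hw1⟩ := hw
  have hw' : 0 ≤ 1 - w := by linarith
  have hmad := sum_binomial_mul_abs_sub_mean_le (t + 1) t.succ_pos hw0 hw1
  rw [Finset.sum_range_succ'] at hmad
  have ha : ((t + 1 : ℕ) : ℝ) * w = w * ((t : ℝ) + 1) := by push_cast; ring
  rw [ha] at hmad
  set a := w * ((t : ℝ) + 1) with ha_def
  have ha0 : 0 < a := by positivity
  have hs : 0 < √a := Real.sqrt_pos.2 ha0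
  have hterm (x : ℕ) : (t.choose x : ℝ) * w ^ x * (1 - w) ^ (t - x) * |a / ((x : ℝ) + 1) - 1|
      = a⁻¹ * (((t + 1).choose (x + 1) : ℝ) * w ^ (x + 1) * (1 - w) ^ (t + 1 - (x + 1))
        * |a - ((x + 1 : ℕ) : ℝ)|) := by
    have hx : (0 : ℝ) < (x : ℝ) + 1 := by positivity
    have hc : ((t : ℝ) + 1) * t.choose x = (t + 1).choose (x + 1) * ((x : ℝ) + 1) := by
      exact_mod_cast Nat.add_one_mul_choose_eq t x
    have habs : |a / ((x : ℝ) + 1) - 1| = |a - (x + 1)| / (x + 1) := by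
      rw [← abs_of_pos hx, ← abs_div, abs_of_pos hx, sub_div, div_self hx.ne']
    rw [habs, Nat.add_sub_add_right, Nat.cast_add_one, eq_inv_mul_iff_mul_eq₀ ha0.ne', mul_div,
      mul_div, div_eq_iff hx.ne', ha_def]
    linear_combination (w ^ (x + 1) * (1 - w) ^ (t - x) * |w * ((t : ℝ) + 1) - (x + 1)|) * hc
  have hzero : 0 ≤ ((t + 1).choose 0 : ℝ) * w ^ 0 * (1 - w) ^ (t + 1 - 0)
      * |a - ((0 : ℕ) : ℝ)| := by positivity
  calc _ ≤ a⁻¹ * √a := by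
        rw [Finset.sum_congr rfl fun x _ => hterm x, ← Finset.mul_sum]
        exact mul_le_mul_of_nonneg_left (by linarith) (by positivity)
    _ = 1 / √a := by
        rw [inv_mul_eq_div, Real.sqrt_div_self']
    _ ≤ 3 / (2 * √a) := by
        rw [div_le_div_iff₀ hs (by positivity)]
        linarith
    _ ≤ _ := le_add_of_nonneg_right (by positivity)
end
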